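/- For every n ≥ 1 and every k ≥ 1, the number of trapezoidal words of length n with exactly k distinct values, i.e., the number of sequences (a_1,...,a_n) with a_i ∈ {1,2,...,2i-1} for each i whose set of values has exactly k elements, equals C_{n,k}, the number of Stirling permutations of length 2n with exactly k plateaux. -/

import Mathlib

/-- A Stirling permutation of length `2*n`. -/
def IsStirlingPerm (n : ℕ) (l : List ℕ) : Prop :=
  l.length = 2 * n ∧
  (∀ i : ℕ, 1 ≤ i → i ≤ n → l.count i = 2) ∧
  ∀ p q r : Fin l.length, p < q → q < r → l.get p = l.get r → l.get p < l.get q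

/-- The extended sequence `a_0 a_1 … a_{2n} a_{2n+1}` with the convention
`a_0 = a_{2n+1} = 0`: `ext l i = a_i`. -/
def ext (l : List ℕ) (i : ℕ) : ℕ := if i = 0 then 0 else l.getD (i - 1) 0

/-- The number of ascents of `l`: indices `i ∈ {0,…,2n}` with `a_i < a_{i+1}`. -/
def ascents (l : List ℕ) : ℕ :=
  ((Finset.range (l.length + 1)).filter (fun i => ext l i < ext l (i + 1))).card

/-- The number of descents of `l`: indices `i ∈ {0,…,2n}` with `a_i > a_{i+1}`. -/
def descents (l : List ℕ) : ℕ :=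
  ((Finset.range (l.length + 1)).filter (fun i => ext l i > ext l (i + 1))).card

/-- The number of plateaux of `l`: indices `i ∈ {0,…,2n}` with `a_i = a_{i+1}`. -/
def plateaux (l : List ℕ) : ℕ :=
  ((Finset.range (l.length + 1)).filter (fun i => ext l i = ext l (i + 1))).card

/-- A trapezoidal word of length `n`: a sequence `(a_1,…,a_n)` with
`a_i ∈ {1,2,…,2i-1}` for each `i` (0-indexed: `1 ≤ a_{j+1} ≤ 2j+1`). -/
def IsTrapezoidalWord (n : ℕ) (l : List ℕ) : Prop :=
  l.length = n ∧ ∀ j : Fin l.length, 1 ≤ l.get j ∧ l.get j ≤ 2 * (j : ℕ) + 1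

/-- Insert two adjacent copies of `m` into `l` at position `i`. -/
def insertTwice (m : ℕ) (l : List ℕ) (i : ℕ) : List ℕ := l.take i ++ m :: m :: l.drop i

/-- The trapezoidal words of length `n`, built by appending letters. -/
def trapezoidalFinset : ℕ → Finset (List ℕ)
  | 0 => {[]}
  | n + 1 => (trapezoidalFinset n ×ˢ Finset.range (2 * n + 1)).image fun p => p.1 ++ [p.2 + 1]

/-- The Stirling permutations of length `2 * n`, built by inserting pairs of maximal letters. -/
def stirlingFinset : ℕ → Finset (List ℕ)
  | 0 => {[]}
  | n + 1 => (stirlingFinset n ×ˢ Finset.range (2 * n + 1)).image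
      fun p => insertTwice (n + 1) p.1 p.2

theorem isTrapezoidalWord_iff {n : ℕ} {l : List ℕ} :
    IsTrapezoidalWord n l ↔
      l.length = n ∧ ∀ (j : ℕ) (h : j < l.length), 1 ≤ l[j] ∧ l[j] ≤ 2 * j + 1 := by
  simp [IsTrapezoidalWord, Fin.forall_iff]

theorem isTrapezoidalWord_append_singleton {n a : ℕ} {l : List ℕ} :
    IsTrapezoidalWord (n + 1) (l ++ [a]) ↔
      IsTrapezoidalWord n l ∧ 1 ≤ a ∧ a ≤ 2 * n + 1 := by
  simp only [isTrapezoidalWord_iff, List.length_append, List.length_singleton,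
    Nat.add_right_cancel_iff]
  constructor
  · rintro ⟨rfl, h⟩
    refine ⟨⟨rfl, fun j hj => ?_⟩, ?_⟩
    · simpa [List.getElem_append_left hj] using h j (by omega)
    · simpa using h l.length (by omega)
  · rintro ⟨⟨rfl, h⟩, ha⟩
    refine ⟨rfl, fun j hj => ?_⟩
    rcases Nat.lt_succ_iff_lt_or_eq.mp hj with hj | rfl
    · simpa [List.getElem_append_left hj] using h j hj
    · simpa using ha

theorem mem_trapezoidalFinset {n : ℕ} {l : List ℕ} :
    l ∈ trapezoidalFinset n ↔ IsTrapezoidalWord n l := by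
  induction n generalizing l with
  | zero =>
    simp only [trapezoidalFinset, Finset.mem_singleton, isTrapezoidalWord_iff]
    constructor
    · rintro rfl
      simp
    · exact fun h => List.length_eq_zero_iff.mp h.1
  | succ n ih =>
    simp only [trapezoidalFinset, Finset.mem_image, Finset.mem_product, Finset.mem_range,
      Prod.exists, ih]
    constructor
    · rintro ⟨u, i, ⟨hu, hi⟩, rfl⟩
      exact isTrapezoidalWord_append_singleton.mpr ⟨hu, by omega, by omega⟩
    · intro h
      rcases List.eq_nil_or_concat' l with rfl | ⟨u, a, rfl⟩
      · simp [IsTrapezoidalWord] at h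
      · obtain ⟨hu, h1, h2⟩ := isTrapezoidalWord_append_singleton.mp h
        exact ⟨u, a - 1, ⟨hu, by omega⟩, by rw [Nat.sub_add_cancel h1]⟩

theorem sum_range_apply_ite {N c : ℕ} {P : ℕ → Prop} [DecidablePred P] (h : ℕ → ℕ)
    (hc : ((Finset.range N).filter P).card = c) :
    ∑ i ∈ Finset.range N, h (if P i then c else c + 1) = c * h c + (N - c) * h (c + 1) := by
  have hn := Finset.card_filter_add_card_filter_not (s := Finset.range N) P
  rw [hc, Finset.card_range] at hn
  simp only [apply_ite h, Finset.sum_ite, Finset.sum_const, hc, smul_eq_mul]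
  congr 2
  omega

theorem card_filter_succ_mem {n : ℕ} {l : List ℕ} (hl : IsTrapezoidalWord n l) :
    ((Finset.range (2 * n + 1)).filter fun i => i + 1 ∈ l).card = l.toFinset.card := by
  rw [isTrapezoidalWord_iff] at hl
  refine Finset.card_bij (fun i _ => i + 1) (by simp) (by simp) fun b hb => ?_
  rw [List.mem_toFinset] at hb
  obtain ⟨j, hj, rfl⟩ := List.getElem_of_mem hb
  have := hl.2 j hj
  refine ⟨l[j] - 1, ?_, by omega⟩
  rw [Finset.mem_filter, Nat.sub_add_cancel this.1, Finset.mem_range]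
  exact ⟨by omega, hb⟩

theorem card_toFinset_append_singleton (l : List ℕ) (a : ℕ) :
    (l ++ [a]).toFinset.card = if a ∈ l then l.toFinset.card else l.toFinset.card + 1 := by
  have : (l ++ [a]).toFinset = insert a l.toFinset := by
    ext x
    simp
  rw [this, Finset.card_insert_eq_ite]
  simp

theorem sum_trapezoidalFinset_succ (n : ℕ) (h : ℕ → ℕ) :
    ∑ l ∈ trapezoidalFinset (n + 1), h l.toFinset.card =
      ∑ l ∈ trapezoidalFinset n, (l.toFinset.card * h l.toFinset.card +
        (2 * n + 1 - l.toFinset.card) * h (l.toFinset.card + 1)) := by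
  rw [trapezoidalFinset, Finset.sum_image, Finset.sum_product]
  · refine Finset.sum_congr rfl fun l hl => ?_
    simp only [card_toFinset_append_singleton]
    exact sum_range_apply_ite h (card_filter_succ_mem (mem_trapezoidalFinset.mp hl))
  · rintro ⟨u, i⟩ - ⟨v, j⟩ - h
    simpa using h

theorem forall_triple_get_iff {l : List ℕ} :
    (∀ p q r : Fin l.length, p < q → q < r → l.get p = l.get r → l.get p < l.get q) ↔
      ∀ x y, [x, y, x].Sublist l → x < y := by
  constructor
  · intro h x y hs
    obtain ⟨f, hf⟩ := List.sublist_iff_exists_fin_orderEmbedding_get_eq.mp hs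
    have h0 := hf ⟨0, by simp⟩
    have h1 := hf ⟨1, by simp⟩
    have h2 := hf ⟨2, by simp⟩
    have := h (f ⟨0, by simp⟩) (f ⟨1, by simp⟩) (f ⟨2, by simp⟩) (by simp) (by simp)
      (by rw [← h0, ← h2]; rfl)
    rwa [← h0, ← h1] at this
  · intro h p q r hpq hqr he
    apply h
    have : [l.get p, l.get q, l.get r] = [p, q, r].map l.get := rfl
    nth_rewrite 2 [he]
    rw [this]
    exact List.map_getElem_sublist (by simp [hpq, hqr, hpq.trans hqr])

theorem IsStirlingPerm.mem_Icc {n : ℕ} {l : List ℕ} (hl : IsStirlingPerm n l) {x : ℕ}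
    (hx : x ∈ l) : 1 ≤ x ∧ x ≤ n := by
  by_contra hn
  have hsub : insert x (Finset.Icc 1 n) ⊆ l.toFinset := by
    intro y hy
    rw [List.mem_toFinset]
    rcases Finset.mem_insert.mp hy with rfl | hy
    · exact hx
    · rw [Finset.mem_Icc] at hy
      exact List.count_pos_iff.mp (by rw [hl.2.1 y hy.1 hy.2]; norm_num)
  have hle := Finset.sum_le_sum_of_subset (f := fun y => l.count y) hsub
  have hlen : ∑ y ∈ l.toFinset, l.count y = l.length := List.sum_toFinset_count_eq_length l
  rw [Finset.sum_insert (by simpa using hn), hlen, hl.1,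
    Finset.sum_congr rfl (g := fun _ => 2) fun y hy => by
      rw [Finset.mem_Icc] at hy; exact hl.2.1 y hy.1 hy.2] at hle
  have := List.count_pos_iff.mpr hx
  simp at hle
  omega

theorem IsStirlingPerm.succ_notMem {n : ℕ} {l : List ℕ} (hl : IsStirlingPerm n l) :
    n + 1 ∉ l := fun h => by
  have := hl.mem_Icc h
  omega

theorem filter_insertTwice {m : ℕ} {l : List ℕ} (hm : m ∉ l) (i : ℕ) :
    (insertTwice m l i).filter (· ≠ m) = l := by
  have : l.filter (· ≠ m) = l := by
    rw [List.filter_eq_self]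
    intro a ha
    simpa using fun h : a = m => hm (h ▸ ha)
  simp only [insertTwice, List.filter_append, List.filter_cons]
  simpa [← List.filter_append] using this

theorem idxOf_insertTwice {m : ℕ} {l : List ℕ} (hm : m ∉ l) {i : ℕ} (hi : i ≤ l.length) :
    (insertTwice m l i).idxOf m = i := by
  rw [insertTwice, List.idxOf_append_of_notMem fun h => hm (List.mem_of_mem_take h)]
  simp [hi]

theorem length_insertTwice (m : ℕ) (l : List ℕ) (i : ℕ) :
    (insertTwice m l i).length = l.length + 2 := by
  simp [insertTwice]
  omega

theorem count_insertTwice (m : ℕ) (l : List ℕ) (i x : ℕ) :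
    (insertTwice m l i).count x = l.count x + if m = x then 2 else 0 := by
  conv_rhs => rw [← List.take_append_drop i l]
  simp only [insertTwice, List.count_append, List.count_cons, beq_iff_eq]
  split_ifs <;> omega

theorem mem_insertTwice {m : ℕ} {l : List ℕ} {i x : ℕ} :
    x ∈ insertTwice m l i ↔ x = m ∨ x ∈ l := by
  conv_rhs => rw [← List.take_append_drop i l]
  simp only [insertTwice, List.mem_append, List.mem_cons]
  tauto

theorem sublist_insertTwice (m : ℕ) (l : List ℕ) (i : ℕ) :
    l.Sublist (insertTwice m l i) := by
  conv_lhs => rw [← List.take_append_drop i l]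
  exact List.Sublist.append_left (by simp) _

theorem not_sublist_insertTwice {m y : ℕ} {l : List ℕ} (hm : m ∉ l) (i : ℕ) :
    ¬ [m, y, m].Sublist (insertTwice m l i) := by
  intro h
  have hu : m ∉ l.take i := fun h => hm (List.mem_of_mem_take h)
  have hv : m ∉ l.drop i := fun h => hm (List.mem_of_mem_drop h)
  have h1 : [m, y, m].Sublist (m :: m :: l.drop i) := by
    obtain ⟨a, b, hab, ha, hb⟩ := List.sublist_append_iff.mp h
    cases a with
    | nil =>
      rw [List.nil_append] at hab
      rwa [hab]
    | cons c a =>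
      rw [List.cons_append, List.cons.injEq] at hab
      exact absurd (ha.subset (by simp [hab.1])) hu
  have h2 : [y, m].Sublist (m :: l.drop i) := by simpa using h1
  cases h2 with
  | cons _ h => exact hv (h.subset (by simp))
  | cons_cons _ h => exact hv (h.subset (by simp))

theorem IsStirlingPerm.insertTwice_succ {n i : ℕ} {l : List ℕ} (hl : IsStirlingPerm n l) :
    IsStirlingPerm (n + 1) (insertTwice (n + 1) l i) := by
  have hm := hl.succ_notMem
  refine ⟨by rw [length_insertTwice, hl.1]; ring, fun x h1 h2 => ?_, ?_⟩
  · rw [count_insertTwice]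
    split_ifs with h
    · rw [← h, List.count_eq_zero_of_not_mem hm]
    · exact hl.2.1 x h1 (by omega)
  · rw [forall_triple_get_iff]
    intro x y hs
    have hx : x ≠ n + 1 := by
      rintro rfl
      exact not_sublist_insertTwice hm i hs
    have hxn := hl.mem_Icc ((mem_insertTwice.mp (hs.subset (by simp))).resolve_left hx)
    by_cases hy : y = n + 1
    · omega
    · refine forall_triple_get_iff.mp hl.2.2 x y ?_
      have := hs.filter (· ≠ n + 1)
      rwa [filter_insertTwice hm, List.filter_eq_self.mpr (by simp [hx, hy])] at this

theorem IsStirlingPerm.exists_insertTwice {n : ℕ} {l : List ℕ} (hl : IsStirlingPerm (n + 1) l) :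
    ∃ u i, IsStirlingPerm n u ∧ i < 2 * n + 1 ∧ insertTwice (n + 1) u i = l := by
  have hc := hl.2.1 (n + 1) (by omega) le_rfl
  have hs := forall_triple_get_iff.mp hl.2.2
  obtain ⟨a, t, rfl, ha⟩ := List.eq_append_cons_of_mem
    (List.count_pos_iff.mp (by rw [hc]; norm_num : 0 < l.count (n + 1)))
  have hct : t.count (n + 1) = 1 := by
    simpa [List.count_append, List.count_eq_zero_of_not_mem ha] using hc
  obtain ⟨w, b, rfl, hw⟩ := List.eq_append_cons_of_mem
    (List.count_pos_iff.mp (by rw [hct]; norm_num : 0 < t.count (n + 1)))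
  have hwnil : w = [] := by
    rw [List.eq_nil_iff_forall_not_mem]
    intro y hy
    have h1 := hl.mem_Icc (x := y) (by simp [hy])
    have h2 : n + 1 < y := by
      apply hs
      refine List.Sublist.trans ?_ (List.sublist_append_right _ _)
      refine List.Sublist.cons_cons _ ?_
      exact List.Sublist.append (l₁ := [y]) (List.singleton_sublist.mpr hy) (by simp)
    omega
  subst hwnil
  have heq : insertTwice (n + 1) (a ++ b) a.length = a ++ (n + 1) :: ([] ++ (n + 1) :: b) := by
    simp [insertTwice]
  rw [← heq] at hl hs
  have hlen := hl.1
  rw [length_insertTwice] at hlen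
  refine ⟨a ++ b, a.length, ⟨by omega, fun x h1 h2 => ?_, ?_⟩, ?_, heq⟩
  · have := hl.2.1 x h1 (by omega)
    rwa [count_insertTwice, if_neg (by omega), Nat.add_zero] at this
  · exact forall_triple_get_iff.mpr fun x y h => hs x y (h.trans (sublist_insertTwice _ _ _))
  · simp at hlen
    omega

theorem mem_stirlingFinset {n : ℕ} {l : List ℕ} :
    l ∈ stirlingFinset n ↔ IsStirlingPerm n l := by
  induction n generalizing l with
  | zero =>
    simp only [stirlingFinset, Finset.mem_singleton]
    constructor
    · rintro rfl
      exact ⟨rfl, fun i h1 h2 => by omega, fun p => p.elim0⟩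
    · exact fun h => List.length_eq_zero_iff.mp h.1
  | succ n ih =>
    simp only [stirlingFinset, Finset.mem_image, Finset.mem_product, Finset.mem_range,
      Prod.exists, ih]
    constructor
    · rintro ⟨u, i, ⟨hu, -⟩, rfl⟩
      exact hu.insertTwice_succ
    · intro h
      obtain ⟨u, i, hu, hi, he⟩ := h.exists_insertTwice
      exact ⟨u, i, ⟨hu, hi⟩, he⟩

theorem ext_insertTwice_of_le {m : ℕ} {l : List ℕ} {i j : ℕ} (hi : i ≤ l.length) (hj : j ≤ i) :
    ext (insertTwice m l i) j = ext l j := by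
  unfold ext insertTwice
  grind

theorem ext_insertTwice_succ {m : ℕ} {l : List ℕ} {i : ℕ} (hi : i ≤ l.length) :
    ext (insertTwice m l i) (i + 1) = m := by
  unfold ext insertTwice
  grind

theorem ext_insertTwice_add_two {m : ℕ} {l : List ℕ} {i : ℕ} (hi : i ≤ l.length) :
    ext (insertTwice m l i) (i + 2) = m := by
  unfold ext insertTwice
  grind

theorem ext_insertTwice_of_lt {m : ℕ} {l : List ℕ} {i j : ℕ} (hi : i ≤ l.length) (hj : i < j) :
    ext (insertTwice m l i) (j + 2) = ext l j := by
  unfold ext insertTwice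
  grind

theorem ext_ne {m : ℕ} {l : List ℕ} (hm : m ∉ l) (hm0 : m ≠ 0) (i : ℕ) : ext l i ≠ m := by
  unfold ext
  grind

theorem plateaux_insertTwice {m : ℕ} {l : List ℕ} (hm : m ∉ l) (hm0 : m ≠ 0) {i : ℕ}
    (hi : i ≤ l.length) :
    plateaux (insertTwice m l i) =
      if ext l i = ext l (i + 1) then plateaux l else plateaux l + 1 := by
  obtain ⟨r, hr⟩ := Nat.exists_eq_add_of_le hi
  have h1 : (insertTwice m l i).length + 1 = (i + 3) + r := by
    rw [length_insertTwice]
    omega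
  have h2 : l.length + 1 = (i + 1) + r := by omega
  have hlow : ∀ j ∈ Finset.range i,
      (if ext (insertTwice m l i) j = ext (insertTwice m l i) (j + 1) then 1 else 0) =
        if ext l j = ext l (j + 1) then 1 else 0 := fun j hj => by
    rw [Finset.mem_range] at hj
    rw [ext_insertTwice_of_le hi hj.le, ext_insertTwice_of_le hi hj]
  have hhigh : ∀ j ∈ Finset.range r,
      (if ext (insertTwice m l i) (i + 3 + j) = ext (insertTwice m l i) (i + 3 + j + 1)
        then 1 else 0) =
        if ext l (i + 1 + j) = ext l (i + 1 + j + 1) then 1 else 0 := fun j _ => by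
    rw [← ext_insertTwice_of_lt (m := m) (j := i + 1 + j) hi (by omega),
      ← ext_insertTwice_of_lt (m := m) (j := i + 1 + j + 1) hi (by omega)]
    congr! 3 <;> omega
  unfold plateaux
  rw [h1, h2]
  simp only [Finset.card_filter]
  rw [Finset.sum_range_add _ (i + 3), Finset.sum_range_add _ (i + 1), Finset.sum_congr rfl hhigh]
  simp only [Finset.sum_range_succ]
  rw [Finset.sum_congr rfl hlow, ext_insertTwice_of_le hi le_rfl, ext_insertTwice_succ hi,
    ext_insertTwice_add_two hi, ext_insertTwice_of_lt hi (Nat.lt_succ_self i),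
    if_neg (ext_ne hm hm0 i), if_neg (ext_ne hm hm0 (i + 1)).symm]
  split_ifs <;> omega

theorem sum_stirlingFinset_succ (n : ℕ) (h : ℕ → ℕ) :
    ∑ l ∈ stirlingFinset (n + 1), h (plateaux l) =
      ∑ l ∈ stirlingFinset n, (plateaux l * h (plateaux l) +
        (2 * n + 1 - plateaux l) * h (plateaux l + 1)) := by
  rw [stirlingFinset, Finset.sum_image, Finset.sum_product]
  · refine Finset.sum_congr rfl fun l hl => ?_
    rw [mem_stirlingFinset] at hl
    rw [← sum_range_apply_ite h (P := fun i => ext l i = ext l (i + 1)) (by rw [plateaux, hl.1])]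
    refine Finset.sum_congr rfl fun i hi => ?_
    rw [Finset.mem_range] at hi
    rw [plateaux_insertTwice hl.succ_notMem (by omega) (by rw [hl.1]; omega)]
  · rintro ⟨u, i⟩ hu ⟨v, j⟩ hv h
    simp only [Finset.coe_product, Set.mem_prod, Finset.mem_coe, mem_stirlingFinset,
      Finset.mem_range] at hu hv h
    have h1 := congrArg (List.filter (· ≠ n + 1)) h
    have h2 := congrArg (List.idxOf (n + 1)) h
    rw [filter_insertTwice hu.1.succ_notMem, filter_insertTwice hv.1.succ_notMem] at h1
    rw [idxOf_insertTwice hu.1.succ_notMem (by rw [hu.1.1]; omega),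
      idxOf_insertTwice hv.1.succ_notMem (by rw [hv.1.1]; omega)] at h2
    rw [h1, h2]

theorem sum_trapezoidalFinset_eq_sum_stirlingFinset (n : ℕ) (h : ℕ → ℕ) :
    ∑ l ∈ trapezoidalFinset (n + 1), h l.toFinset.card =
      ∑ l ∈ stirlingFinset (n + 1), h (plateaux l) := by
  induction n generalizing h with
  | zero =>
    have : plateaux [] = 1 := by decide
    rw [sum_trapezoidalFinset_succ, sum_stirlingFinset_succ]
    simp [trapezoidalFinset, stirlingFinset, this]
  | succ n ih =>
    rw [sum_trapezoidalFinset_succ, sum_stirlingFinset_succ]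
    exact ih fun c => c * h c + (2 * (n + 1) + 1 - c) * h (c + 1)

/-- For every `n ≥ 1` and every `k ≥ 1`, the number of trapezoidal words of length `n`
with exactly `k` distinct values equals the number of Stirling permutations of length
`2n` with exactly `k` plateaux. -/
theorem trapezoidal_word_count (n k : ℕ) (hn : 1 ≤ n) (hk : 1 ≤ k) :
    {l : List ℕ | IsTrapezoidalWord n l ∧ l.toFinset.card = k}.ncard
      = {l : List ℕ | IsStirlingPerm n l ∧ plateaux l = k}.ncard := by
  obtain ⟨n, rfl⟩ := Nat.exists_eq_add_of_le' hn
  have hT : {l : List ℕ | IsTrapezoidalWord (n + 1) l ∧ l.toFinset.card = k} =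
      ((trapezoidalFinset (n + 1)).filter fun l => l.toFinset.card = k : Finset (List ℕ)) := by
    ext l
    simp [mem_trapezoidalFinset]
  have hS : {l : List ℕ | IsStirlingPerm (n + 1) l ∧ plateaux l = k} =
      ((stirlingFinset (n + 1)).filter fun l => plateaux l = k : Finset (List ℕ)) := by
    ext l
    simp [mem_stirlingFinset]
  rw [hT, hS, Set.ncard_coe_finset, Set.ncard_coe_finset, Finset.card_filter, Finset.card_filter]
  exact sum_trapezoidalFinset_eq_sum_stirlingFinset n fun c => if c = k then 1 else 0
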